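/- arXiv:2002.02622 — 10 statements merged into one kernel-verified Lean document; each statement's English description precedes it below -/
import Mathlib

section
/- Let e(a,b) = 2b(a−b)/(1+(a−b)²). For all real numbers a, b with 0 ≤ b ≤ a ≤ 1, one has e(a,b) ≤ √2 − 1, and e(1, 2−√2) = √2 − 1. Hence the maximum excess when folding a unit square page is √2 − 1, attained at a = 1, b = 2 − √2. -/
/-- The case-2 excess `e(a,b) = 2b(a−b)/(1+(a−b)²)`. -/
noncomputable def excess (a b : ℝ) : ℝ := 2 * b * (a - b) / (1 + (a - b) ^ 2)

/-- The maximum excess when folding a unit square page is `√2 − 1`,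
attained at `a = 1`, `b = 2 − √2`. -/
theorem square_optimal_fold :
    (∀ a b : ℝ, 0 ≤ b → b ≤ a → a ≤ 1 → excess a b ≤ Real.sqrt 2 - 1) ∧
    excess 1 (2 - Real.sqrt 2) = Real.sqrt 2 - 1 := by
  have hs : Real.sqrt 2 ^ 2 = 2 := Real.sq_sqrt (by norm_num)
  unfold excess
  refine ⟨fun a b _ hba ha => ?_, ?_⟩
  · rw [div_le_iff₀ (by positivity)]
    have hsq : 0 ≤ (Real.sqrt 2 + 1) * (a - b - (Real.sqrt 2 - 1)) ^ 2 := by positivity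
    have hmul : 0 ≤ (1 - a) * (a - b) := mul_nonneg (by linarith) (by linarith)
    have hid : (Real.sqrt 2 + 1) * (a - b - (Real.sqrt 2 - 1)) ^ 2 =
        (Real.sqrt 2 - 1) * (1 + (a - b) ^ 2) - 2 * b * (a - b) - 2 * ((1 - a) * (a - b)) := by
      linear_combination (Real.sqrt 2 - 1 - 2 * (a - b)) * hs
    linarith
  · rw [div_eq_iff (by positivity)]
    linear_combination (1 - Real.sqrt 2) * hs
end

section
/- The cubic polynomial p(x) = x³ − 2√2·x² + 4x − √2 has exactly one real root x₀, and x₀² equals b₀ := (7√33 + 9)^{1/3}/9^{1/3} − 8/(3(7√33 + 9))^{1/3}. In particular x₀ = √b₀ > 0 and b₀ is the unique real number b ≥ 0 satisfying (√b)³ − 2√2·b + 4√b − √2 = 0. -/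
/-- The closed-form constant `b₀` from the constrained square-page problem. -/
noncomputable def b₀ : ℝ :=
  (7 * Real.sqrt 33 + 9) ^ ((1 : ℝ) / 3) / (9 : ℝ) ^ ((1 : ℝ) / 3) -
    8 / (3 * (7 * Real.sqrt 33 + 9)) ^ ((1 : ℝ) / 3)

theorem b₀_cubic : b₀ ^ 3 + 8 * b₀ - 2 = 0 := by
  have hr : Real.sqrt 33 ^ 2 = 33 := Real.sq_sqrt (by norm_num)
  have hs : 0 < 7 * Real.sqrt 33 + 9 := by positivity
  have cube_rpow (x : ℝ) (hx : 0 < x) : (x ^ ((1 : ℝ) / 3)) ^ 3 = x := by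
    rw [← Real.rpow_natCast, ← Real.rpow_mul hx.le]
    norm_num
  have h9 : (9 : ℝ) ^ ((1 : ℝ) / 3) = ((3 : ℝ) ^ ((1 : ℝ) / 3)) ^ 2 := by
    rw [show (9 : ℝ) = 3 * 3 by norm_num, Real.mul_rpow (by norm_num) (by norm_num), sq]
  unfold b₀
  rw [Real.mul_rpow (by norm_num) hs.le, h9]
  have ha := cube_rpow _ hs
  have he := cube_rpow 3 (by norm_num)
  have ha_pos : 0 < (7 * Real.sqrt 33 + 9) ^ ((1 : ℝ) / 3) := Real.rpow_pos_of_pos hs _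
  have he_pos : 0 < (3 : ℝ) ^ ((1 : ℝ) / 3) := Real.rpow_pos_of_pos (by norm_num) _
  generalize (7 * Real.sqrt 33 + 9) ^ ((1 : ℝ) / 3) = a at *
  generalize (3 : ℝ) ^ ((1 : ℝ) / 3) = e at *
  have h_mul : a / e ^ 2 * (8 / (e * a)) = 8 / 3 := by
    rw [← he]
    field_simp
  have h_sub : (a / e ^ 2) ^ 3 - (8 / (e * a)) ^ 3 = 2 := by
    have h₁ : (a / e ^ 2) ^ 3 = (7 * Real.sqrt 33 + 9) / 9 := by
      rw [div_pow, ha, ← pow_mul, mul_comm 2 3, pow_mul, he]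
      norm_num
    have h₂ : (8 / (e * a)) ^ 3 = 512 / (3 * (7 * Real.sqrt 33 + 9)) := by
      rw [div_pow, mul_pow, ha, he]
      norm_num
    rw [h₁, h₂]
    field_simp
    nlinarith [hr]
  linear_combination h_sub - 3 * (a / e ^ 2 - 8 / (e * a)) * h_mul

theorem b₀_pos : 0 < b₀ := by
  nlinarith [b₀_cubic, sq_nonneg b₀]

theorem sqrt_b₀_root :
    (Real.sqrt b₀) ^ 3 - 2 * Real.sqrt 2 * b₀ + 4 * Real.sqrt b₀ - Real.sqrt 2 = 0 := by
  have hb := b₀_pos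
  have hy : Real.sqrt b₀ ^ 2 = b₀ := Real.sq_sqrt hb.le
  have h2 : Real.sqrt 2 ^ 2 = 2 := Real.sq_sqrt (by norm_num)
  have h : Real.sqrt b₀ * (b₀ + 4) = Real.sqrt 2 * (2 * b₀ + 1) := by
    rw [← sq_eq_sq₀ (by positivity) (by positivity), mul_pow, mul_pow, hy, h2]
    linear_combination b₀_cubic
  linear_combination h + Real.sqrt b₀ * hy

theorem cubic_root_unique {x y : ℝ}
    (hx : x ^ 3 - 2 * Real.sqrt 2 * x ^ 2 + 4 * x - Real.sqrt 2 = 0)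
    (hy : y ^ 3 - 2 * Real.sqrt 2 * y ^ 2 + 4 * y - Real.sqrt 2 = 0) : x = y := by
  have h2 : Real.sqrt 2 ^ 2 = 2 := Real.sq_sqrt (by norm_num)
  have h_pos : 0 < x ^ 2 + x * y + y ^ 2 - 2 * Real.sqrt 2 * (x + y) + 4 := by
    nlinarith [sq_nonneg (x - y), sq_nonneg (3 * (x + y) - 4 * Real.sqrt 2)]
  have h_mul : (x - y) * (x ^ 2 + x * y + y ^ 2 - 2 * Real.sqrt 2 * (x + y) + 4) = 0 := by
    linear_combination hx - hy
  exact sub_eq_zero.mp ((mul_eq_zero.mp h_mul).resolve_right h_pos.ne')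

/-- The cubic `x³ − 2√2·x² + 4x − √2` has exactly one real root `x₀`; it is
positive, equals `√b₀`, and `x₀² = b₀`. Moreover `b₀` is the unique `b ≥ 0`
with `(√b)³ − 2√2·b + 4√b − √2 = 0`. -/
theorem cubic_unique_root :
    (∃! x : ℝ, x ^ 3 - 2 * Real.sqrt 2 * x ^ 2 + 4 * x - Real.sqrt 2 = 0) ∧
    (∀ x : ℝ, x ^ 3 - 2 * Real.sqrt 2 * x ^ 2 + 4 * x - Real.sqrt 2 = 0 →
      0 < x ∧ x = Real.sqrt b₀ ∧ x ^ 2 = b₀) ∧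
    (∃! b : ℝ, 0 ≤ b ∧
      (Real.sqrt b) ^ 3 - 2 * Real.sqrt 2 * b + 4 * Real.sqrt b - Real.sqrt 2 = 0) ∧
    (0 ≤ b₀ ∧
      (Real.sqrt b₀) ^ 3 - 2 * Real.sqrt 2 * b₀ + 4 * Real.sqrt b₀ - Real.sqrt 2 = 0) := by
  have hb := b₀_pos
  have hy : Real.sqrt b₀ ^ 2 = b₀ := Real.sq_sqrt hb.le
  have h_root : Real.sqrt b₀ ^ 3 - 2 * Real.sqrt 2 * Real.sqrt b₀ ^ 2 + 4 * Real.sqrt b₀ -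
      Real.sqrt 2 = 0 := by
    rw [hy]
    exact sqrt_b₀_root
  refine ⟨⟨_, h_root, fun x hx => cubic_root_unique hx h_root⟩, fun x hx => ?_,
    ⟨b₀, ⟨hb.le, sqrt_b₀_root⟩, fun b ⟨hb_nonneg, h⟩ => ?_⟩, hb.le, sqrt_b₀_root⟩
  · obtain rfl := cubic_root_unique hx h_root
    exact ⟨Real.sqrt_pos.mpr hb, rfl, hy⟩
  · have hsq : Real.sqrt b ^ 2 = b := Real.sq_sqrt hb_nonneg
    have h_eq : Real.sqrt b = Real.sqrt b₀ := cubic_root_unique (by rw [hsq]; exact h) h_root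
    rw [← hsq, h_eq, hy]
end

section
/- Let e(a,b) = 2b(a−b)/(1+(a−b)²), let b₀ = (7√33 + 9)^{1/3}/9^{1/3} − 8/(3(7√33 + 9))^{1/3}, and let a₀ = 1 + b₀ − √(2b₀). Then 0 ≤ b₀ ≤ a₀ ≤ 1, 2a₀ = 1 + (a₀−b₀)², and for all real numbers a, b with 0 ≤ b ≤ a ≤ 1 and 2a ≤ 1 + (a−b)², one has e(a,b) ≤ e(a₀,b₀). That is, (a₀,b₀) is the optimal fold of the unit square page subject to the constraint that the fold not exceed the top edge. -/
/-- The corresponding `a₀` on the nonlinear boundary. -/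
noncomputable def a₀ : ℝ := 1 + b₀ - Real.sqrt (2 * b₀)

/-- On the boundary `2b = (1 - d)²` the excess is maximal at the root `p` of
`1 - 3p - p² - p³`. -/
theorem boundary_excess_le {p d : ℝ} (hp : 0 < p) (hc : 1 - 3 * p - p ^ 2 - p ^ 3 = 0)
    (hd : d ≤ 1) :
    (1 - d) ^ 2 * d / (1 + d ^ 2) ≤ (1 - p) ^ 2 * p / (1 + p ^ 2) := by
  rw [div_le_div_iff₀ (by positivity) (by positivity)]
  have hfac : p * ((1 - p) ^ 2 * p * (1 + d ^ 2) - (1 - d) ^ 2 * d * (1 + p ^ 2)) =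
      (d - p) ^ 2 * ((1 - p) ^ 2 - p * (1 + p ^ 2) * d) := by
    linear_combination (p - 1) * (d ^ 2 - p * d) * hc
  have hlin : 0 ≤ (1 - p) ^ 2 - p * (1 + p ^ 2) * d := by
    have : p * (1 + p ^ 2) * d ≤ p * (1 + p ^ 2) * 1 := by gcongr
    nlinarith [sq_nonneg p]
  have := nonneg_of_mul_nonneg_right (hfac ▸ mul_nonneg (sq_nonneg (d - p)) hlin) hp
  linarith

/-- `(a₀, b₀)` is the optimal fold of the unit square page subject to the
constraint that the fold not exceed the top edge. -/
theorem constrained_square_optimum :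
    (0 ≤ b₀ ∧ b₀ ≤ a₀ ∧ a₀ ≤ 1) ∧
    2 * a₀ = 1 + (a₀ - b₀) ^ 2 ∧
    (∀ a b : ℝ, 0 ≤ b → b ≤ a → a ≤ 1 → 2 * a ≤ 1 + (a - b) ^ 2 →
      excess a b ≤ excess a₀ b₀) := by
  have hb := b₀_cubic
  have hb0 : 0 < b₀ := by nlinarith [sq_nonneg b₀]
  have hb1 : b₀ < 1 / 2 := by nlinarith [pow_pos hb0 3]
  have hs : Real.sqrt (2 * b₀) ^ 2 = 2 * b₀ := Real.sq_sqrt (by linarith)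
  have hs0 : 0 < Real.sqrt (2 * b₀) := Real.sqrt_pos.2 (by linarith)
  have ha : a₀ = 1 + b₀ - Real.sqrt (2 * b₀) := rfl
  generalize Real.sqrt (2 * b₀) = s at *
  generalize a₀ = a' at *
  have hbs : b₀ = s ^ 2 / 2 := by linarith
  generalize b₀ = b' at *
  subst hbs ha
  have hs1 : s < 1 := by nlinarith
  have hsc : s ^ 3 + 8 * s = 4 * (s ^ 2 + 1) := by
    rw [← sq_eq_sq₀ (by positivity) (by positivity)]
    linear_combination 8 * hb
  refine ⟨⟨by positivity, by linarith, by nlinarith⟩, by ring, fun a b h0 hab h1 h => ?_⟩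
  calc excess a b ≤ (1 - (a - b)) ^ 2 * (a - b) / (1 + (a - b) ^ 2) := by
        unfold excess
        have : 0 ≤ a - b := by linarith
        gcongr
        linarith
    _ ≤ (1 - (1 - s)) ^ 2 * (1 - s) / (1 + (1 - s) ^ 2) :=
        boundary_excess_le (by linarith) (by linear_combination hsc) (by linarith)
    _ = excess (1 + s ^ 2 / 2 - s) (s ^ 2 / 2) := by
        unfold excess
        congr 1 <;> ring
end

section
/- Let e(a,b) = 2b(a−b)/(1+(a−b)²), b₀ = (7√33 + 9)^{1/3}/9^{1/3} − 8/(3(7√33 + 9))^{1/3}, and a₀ = 1 + b₀ − √(2b₀). Then 0.134 < e(a₀,b₀) < 0.136; moreover the point (a,b) = (1/2, 1/4) satisfies the constraints 0 ≤ b ≤ a ≤ 1 and 2a ≤ 1 + (a−b)², with e(1/2, 1/4) = 2/17. -/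
/-- With `t` the real cube root of `1 + 7√33/9`, the constant `b₀` equals `t - 8 / (3t)`. -/
theorem exists_cube_root_b₀ :
    ∃ t : ℝ, 0 < t ∧ t ^ 3 = (7 * Real.sqrt 33 + 9) / 9 ∧ b₀ = t - 8 / (3 * t) := by
  have hq : (0 : ℝ) < 7 * Real.sqrt 33 + 9 := by positivity
  have hcube : ∀ x : ℝ, 0 ≤ x → (x ^ ((1 : ℝ) / 3)) ^ 3 = x := fun x hx => by
    rw [← Real.rpow_natCast, ← Real.rpow_mul hx]
    norm_num
  have h27 : (27 : ℝ) ^ ((1 : ℝ) / 3) = 3 := by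
    rw [show (27 : ℝ) = 3 ^ (3 : ℝ) by norm_num, ← Real.rpow_mul (by norm_num)]
    norm_num
  refine ⟨((7 * Real.sqrt 33 + 9) / 9) ^ ((1 : ℝ) / 3), by positivity,
    hcube _ (by positivity), ?_⟩
  rw [b₀, ← Real.div_rpow hq.le (by norm_num),
    show 3 * (7 * Real.sqrt 33 + 9) = 27 * ((7 * Real.sqrt 33 + 9) / 9) by ring,
    Real.mul_rpow (by norm_num) (by positivity), h27]

theorem b₀_bounds : 0.2478082 < b₀ ∧ b₀ < 0.2485 := by
  obtain ⟨t, ht, ht3, hb⟩ := exists_cube_root_b₀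
  have hs₁ : 5.7445 < Real.sqrt 33 := Real.lt_sqrt_of_sq_lt (by norm_num)
  have hs₂ : Real.sqrt 33 < 5.7446 := (Real.sqrt_lt' (by norm_num)).2 (by norm_num)
  have ht₁ : 1.7617 < t := lt_of_pow_lt_pow_left₀ 3 ht.le (by rw [ht3]; linarith)
  have ht₂ : t < 1.7618 := lt_of_pow_lt_pow_left₀ 3 (by norm_num) (by rw [ht3]; linarith)
  have h₁ : 8 / (3 * t) < 8 / (3 * 1.7617) := by gcongr
  have h₂ : 8 / (3 * 1.7618) < 8 / (3 * t) := by gcongr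
  rw [hb]
  norm_num at h₁ h₂ ⊢
  constructor <;> linarith

theorem excess_a₀_b₀ (h : 0 ≤ b₀) :
    excess a₀ b₀ = Real.sqrt (2 * b₀) ^ 2 * (1 - Real.sqrt (2 * b₀)) /
      (1 + (1 - Real.sqrt (2 * b₀)) ^ 2) := by
  rw [excess, a₀, Real.sq_sqrt (by positivity)]
  ring_nf

/-- Numerics of the constrained square optimum, and the feasible
approximation `(1/2, 1/4)` with excess `2/17`. -/
theorem constrained_optimum_numerics :
    (0.134 < excess a₀ b₀ ∧ excess a₀ b₀ < 0.136) ∧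
    (0 ≤ (1 / 4 : ℝ) ∧ (1 / 4 : ℝ) ≤ 1 / 2 ∧ (1 / 2 : ℝ) ≤ 1 ∧
      2 * (1 / 2 : ℝ) ≤ 1 + ((1 / 2 : ℝ) - 1 / 4) ^ 2) ∧
    excess (1 / 2) (1 / 4) = 2 / 17 := by
  obtain ⟨hb₁, hb₂⟩ := b₀_bounds
  have hs₁ : 0.704 < Real.sqrt (2 * b₀) := Real.lt_sqrt_of_sq_lt (by norm_num at hb₁ ⊢; linarith)
  have hs₂ : Real.sqrt (2 * b₀) < 0.705 :=
    (Real.sqrt_lt' (by norm_num)).2 (by norm_num at hb₂ ⊢; linarith)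
  refine ⟨?_, by norm_num, by norm_num [excess]⟩
  rw [excess_a₀_b₀ (by linarith)]
  generalize Real.sqrt (2 * b₀) = s at hs₁ hs₂
  have hd₁ : 0.295 < 1 - s := by linarith
  have hd₂ : 1 - s < 0.296 := by linarith
  have hd₀ : 0 < 1 - s := by linarith
  constructor
  · calc (0.134 : ℝ) < 0.704 ^ 2 * 0.295 / (1 + 0.296 ^ 2) := by norm_num
      _ < s ^ 2 * (1 - s) / (1 + (1 - s) ^ 2) := by gcongr
  · calc s ^ 2 * (1 - s) / (1 + (1 - s) ^ 2) < 0.705 ^ 2 * 0.296 / (1 + 0.295 ^ 2) := by gcongr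
      _ < 0.136 := by norm_num
end

section
/- Let A ≥ 1 be a real number. For all real numbers a, b with 0 ≤ b ≤ 1 ≤ a ≤ A, one has 2a²b/(a²+b²) ≤ 2A²/(A²+1), with equality at a = A, b = 1. Consequently the maximum excess of the case-1 fold of an A×1 rectangular page is 2A²/(A²+1) − 1 = (A²−1)/(A²+1), which is strictly less than 1 for every A, and (A²−1)/(A²+1) tends to 1 as A tends to infinity. -/
/-- Case-1 fold of an `A×1` rectangular page: the reach `2a²b/(a²+b²)` is
maximized along the diagonal (`a = A`, `b = 1`), the maximal excess
`(A²−1)/(A²+1)` is less than `1`, and it tends to `1` as `A → ∞`. -/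
theorem case1_rectangle_optimum (A : ℝ) (hA : 1 ≤ A) :
    (∀ a b : ℝ, 0 ≤ b → b ≤ 1 → 1 ≤ a → a ≤ A →
      2 * a ^ 2 * b / (a ^ 2 + b ^ 2) ≤ 2 * A ^ 2 / (A ^ 2 + 1)) ∧
    2 * A ^ 2 * 1 / (A ^ 2 + 1 ^ 2) = 2 * A ^ 2 / (A ^ 2 + 1) ∧
    2 * A ^ 2 / (A ^ 2 + 1) - 1 = (A ^ 2 - 1) / (A ^ 2 + 1) ∧
    (A ^ 2 - 1) / (A ^ 2 + 1) < 1 ∧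
    Filter.Tendsto (fun A : ℝ => (A ^ 2 - 1) / (A ^ 2 + 1)) Filter.atTop (nhds 1) := by
  refine ⟨fun a b hb hb1 ha haA => ?_, by norm_num, ?_, ?_, ?_⟩
  · have hA2 : 0 ≤ A ^ 2 - a ^ 2 := by nlinarith
    have hab : 0 ≤ a ^ 2 - b := by nlinarith
    have hb' : 0 ≤ 1 - b := by linarith
    have h₁ : 0 ≤ (A ^ 2 - a ^ 2) * (a ^ 2 * (1 - b) + b ^ 2) := by positivity
    have h₂ : 0 ≤ a ^ 2 * (1 - b) * (a ^ 2 - b) := by positivity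
    rw [div_le_div_iff₀ (by positivity) (by positivity)]
    linarith
  · have h : A ^ 2 + 1 ≠ 0 := by positivity
    field_simp
    ring
  · rw [div_lt_one (by positivity)]
    linarith
  · have h : Filter.Tendsto (fun x : ℝ => 1 - 2 / (x ^ 2 + 1)) Filter.atTop (nhds (1 - 0)) :=
      tendsto_const_nhds.sub (Filter.Tendsto.const_div_atTop
        (Filter.tendsto_atTop_add_const_right _ _ (Filter.tendsto_pow_atTop two_ne_zero)) 2)
    rw [sub_zero] at h
    refine h.congr fun x => ?_
    have hx : x ^ 2 + 1 ≠ 0 := by positivity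
    field_simp
    ring
end

section
/- Let e(a,b) = 2b(a−b)/(1+(a−b)²) and let A ≥ 1 be a real number. For all real numbers a, b with 0 ≤ b ≤ a ≤ A, one has e(a,b) ≤ √(1+A²) − 1; moreover, setting b* = (1 + A² − √(1+A²))/A one has 0 ≤ b* ≤ A and e(A, b*) = √(1+A²) − 1. Hence the maximum excess of the case-2 fold of an A×1 rectangular page is √(1+A²) − 1. -/
/-- The maximum excess of the case-2 fold of an `A×1` rectangular page is
`√(1+A²) − 1`, attained at `a = A`, `b = (1 + A² − √(1+A²))/A`. -/
theorem case2_rectangle_optimum (A : ℝ) (hA : 1 ≤ A) :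
    (∀ a b : ℝ, 0 ≤ b → b ≤ a → a ≤ A → excess a b ≤ Real.sqrt (1 + A ^ 2) - 1) ∧
    (0 ≤ (1 + A ^ 2 - Real.sqrt (1 + A ^ 2)) / A ∧
      (1 + A ^ 2 - Real.sqrt (1 + A ^ 2)) / A ≤ A) ∧
    excess A ((1 + A ^ 2 - Real.sqrt (1 + A ^ 2)) / A) = Real.sqrt (1 + A ^ 2) - 1 := by
  have hA0 : 0 < A := by linarith
  have hs : √(1 + A ^ 2) ^ 2 = 1 + A ^ 2 := Real.sq_sqrt (by positivity)
  have hs1 : 1 ≤ √(1 + A ^ 2) := Real.one_le_sqrt.mpr (by nlinarith)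
  generalize √(1 + A ^ 2) = s at hs hs1 ⊢
  refine ⟨fun a b _ hba haA => ?_, ⟨?_, ?_⟩, ?_⟩
  · unfold excess
    rw [div_le_iff₀ (by positivity)]
    obtain ⟨d, rfl⟩ : ∃ d, a = b + d := ⟨a - b, by ring⟩
    rw [add_sub_cancel_left]
    have hd : 0 ≤ d := by linarith
    have hbd : b * d ≤ (A - d) * d := mul_le_mul_of_nonneg_right (by linarith) hd
    have hquad : 0 ≤ (s + 1) * d ^ 2 - 2 * A * d + (s - 1) := by
      refine nonneg_of_mul_nonneg_right (a := s + 1) ?_ (by linarith)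
      have hsq : (s + 1) * ((s + 1) * d ^ 2 - 2 * A * d + (s - 1)) = ((s + 1) * d - A) ^ 2 := by
        linear_combination hs
      rw [hsq]
      positivity
    linarith
  · apply div_nonneg _ hA0.le
    nlinarith
  · rw [div_le_iff₀ hA0]
    linarith
  · have hb : (1 + A ^ 2 - s) / A = s * ((s - 1) / A) := by
      rw [← hs]; ring
    have hd : A - (1 + A ^ 2 - s) / A = (s - 1) / A := by
      field_simp; ring
    unfold excess
    rw [hd, hb, div_eq_iff (by positivity)]
    field_simp
    linear_combination (s - 1) * hs
end

section
/- Let e(a,b) = 2b(a−b)/(1+(a−b)²). For every real A ≥ 1, e(A, A−1) = A − 1 and 2A/(1 + (A−(A−1))²) = A (so the fold with a = A, b = A−1 does not exceed the top edge of the page), and (√(1+A²) − 1) − (A − 1) tends to 0 as A tends to infinity; i.e., the regular fold (A, A−1) is asymptotically optimal for long narrow pages. -/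
/-- The regular fold `(A, A−1)` has excess `A − 1`, does not exceed the top
edge, and is asymptotically optimal as `A → ∞`. -/
theorem regular_fold_asymptotically_optimal :
    (∀ A : ℝ, 1 ≤ A → excess A (A - 1) = A - 1) ∧
    (∀ A : ℝ, 1 ≤ A → 2 * A / (1 + (A - (A - 1)) ^ 2) = A) ∧
    Filter.Tendsto (fun A : ℝ => (Real.sqrt (1 + A ^ 2) - 1) - (A - 1))
      Filter.atTop (nhds 0) := by
  refine ⟨fun A _ => ?_, fun A _ => ?_, ?_⟩
  · rw [excess, sub_sub_cancel]
    ring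
  · rw [sub_sub_cancel]
    ring
  · refine tendsto_of_tendsto_of_tendsto_of_le_of_le' tendsto_const_nhds
      tendsto_inv_atTop_zero ?_ ?_
    · filter_upwards [Filter.eventually_gt_atTop (0 : ℝ)] with A hA
      have h : A ≤ Real.sqrt (1 + A ^ 2) := Real.le_sqrt_of_sq_le (by linarith)
      linarith
    · filter_upwards [Filter.eventually_gt_atTop (0 : ℝ)] with A hA
      have h : Real.sqrt (1 + A ^ 2) ≤ A + A⁻¹ := by
        refine Real.sqrt_le_iff.mpr ⟨by positivity, ?_⟩
        have h_mul : A * A⁻¹ = 1 := mul_inv_cancel₀ hA.ne'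
        nlinarith [sq_nonneg A⁻¹]
      linarith
end

section
/- Let e(a,b) = 2b(a−b)/(1+(a−b)²) and let A ≥ 1 be a real number. For every real a with A/2 ≤ a ≤ A, setting b = a − √((2a − A)/A) one has 0 ≤ b ≤ a, 2a = A(1 + (a−b)²), and e(a, b) = A/a + √(A(2a − A)) − 2. -/
/-- Parametrization of the nonlinear boundary `2a = A(1 + (a−b)²)` of the
constrained rectangular-page problem by `b = a − √((2a − A)/A)`, with the excess
along it equal to `A/a + √(A(2a − A)) − 2`. -/
theorem rect_boundary_parametrization (A a : ℝ) (hA : 1 ≤ A)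
    (ha1 : A / 2 ≤ a) (ha2 : a ≤ A) :
    (0 ≤ a - Real.sqrt ((2 * a - A) / A) ∧ a - Real.sqrt ((2 * a - A) / A) ≤ a) ∧
    2 * a = A * (1 + (a - (a - Real.sqrt ((2 * a - A) / A))) ^ 2) ∧
    excess a (a - Real.sqrt ((2 * a - A) / A)) =
      A / a + Real.sqrt (A * (2 * a - A)) - 2 := by
  have hA0 : 0 < A := by linarith
  have ha0 : 0 < a := by linarith
  have hq : 0 ≤ (2 * a - A) / A := div_nonneg (by linarith) hA0.le
  have hle : Real.sqrt ((2 * a - A) / A) ≤ a := by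
    rw [Real.sqrt_le_left ha0.le, div_le_iff₀ hA0]
    nlinarith [sq_nonneg (a - 1), mul_nonneg (sub_nonneg.2 hA) (sq_nonneg a)]
  have hsq : A * Real.sqrt ((2 * a - A) / A) ^ 2 = 2 * a - A := by
    rw [Real.sq_sqrt hq, mul_div_cancel₀ _ hA0.ne']
  have hmul : Real.sqrt (A * (2 * a - A)) = A * Real.sqrt ((2 * a - A) / A) := by
    rw [Real.sqrt_eq_iff_mul_self_eq (mul_nonneg hA0.le (by linarith)) (by positivity)]
    linear_combination -A * hsq
  have hs0 := Real.sqrt_nonneg ((2 * a - A) / A)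
  rw [hmul, excess]
  generalize Real.sqrt ((2 * a - A) / A) = s at *
  refine ⟨⟨by linarith, by linarith⟩, by linear_combination -hsq, ?_⟩
  have hden : 1 + (a - (a - s)) ^ 2 = 2 * a / A := by
    rw [eq_div_iff hA0.ne']
    linear_combination hsq
  rw [hden]
  field_simp
  linear_combination -hsq
end

section
/- Define g_A(a) = A/a + √(A(2a − A)) − 2 for a ∈ [A/2, A]. There exists a real number A_cr with 1.207 < A_cr < 1.208 such that: (i) for every A with 1 < A < A_cr there exists a ∈ (A/2, A) with g_A(a) > A − 1; and (ii) for every A > A_cr and every a ∈ [A/2, A], g_A(a) ≤ A − 1. Moreover any A_cr satisfying (i) and (ii) is unique. (Thus the constrained optimal fold of a rectangular page undergoes a first-order transition at A = A_cr ≈ 1.20711: for A > A_cr the optimum is the regular fold a = A, b = A − 1 with excess A − 1, while for 1 < A < A_cr the optimum lies strictly inside the boundary curve.) -/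
/-- The excess along the boundary curve of the constrained rectangular-page
problem: `g_A(a) = A/a + √(A(2a − A)) − 2`. -/
noncomputable def g (A a : ℝ) : ℝ := A / a + Real.sqrt (A * (2 * a - A)) - 2

/-- On the boundary curve parametrised by `a = A (1 + s²) / 2`, the excess is
`2 / (1 + s²) + A s - 2`. -/
lemma g_param {A s : ℝ} (hA : 0 < A) (hs : 0 ≤ s) :
    g A (A * (1 + s ^ 2) / 2) = 2 / (1 + s ^ 2) + A * s - 2 := by
  have hsqrt : Real.sqrt (A * (2 * (A * (1 + s ^ 2) / 2) - A)) = A * s := by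
    rw [show A * (2 * (A * (1 + s ^ 2) / 2) - A) = (A * s) ^ 2 by ring]
    exact Real.sqrt_sq (by positivity)
  have hdiv : A / (A * (1 + s ^ 2) / 2) = 2 / (1 + s ^ 2) := by
    have : 1 + s ^ 2 ≠ 0 := by positivity
    field_simp
  rw [g, hsqrt, hdiv]

/-- Difference between the regular-fold excess and the boundary excess. -/
lemma sub_g_param {A s : ℝ} (hA : 0 < A) (hs : 0 ≤ s) :
    A - 1 - g A (A * (1 + s ^ 2) / 2) =
      (1 - s) * (A * (1 + s ^ 2) - (1 + s)) / (1 + s ^ 2) := by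
  have : 1 + s ^ 2 ≠ 0 := by positivity
  rw [g_param hA hs]
  field_simp
  ring

/-- The square completion at the optimal parameter `s = √2 - 1`. -/
lemma critical_mul_sub (s : ℝ) :
    (1 + √2) / 2 * (1 + s ^ 2) - (1 + s) = (1 + √2) / 2 * (s - (√2 - 1)) ^ 2 := by
  have h2 : √2 ^ 2 = 2 := Real.sq_sqrt (by norm_num)
  linear_combination (s - (√2 - 1) / 2) * h2

lemma exists_lt_g {A : ℝ} (hA : 0 < A) (hcr : A < (1 + √2) / 2) :
    ∃ a : ℝ, A / 2 < a ∧ a < A ∧ A - 1 < g A a := by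
  have h1 : 1 < √2 := Real.lt_sqrt_of_sq_lt (by norm_num)
  have h2 : √2 < 2 := (Real.sqrt_lt' (by norm_num)).2 (by norm_num)
  have hcrit := critical_mul_sub (√2 - 1)
  obtain ⟨s, hs⟩ : ∃ s, s = √2 - 1 := ⟨_, rfl⟩
  rw [← hs, sub_self] at hcrit
  have hs0 : 0 < s := by linarith
  have hs1 : s < 1 := by linarith
  refine ⟨A * (1 + s ^ 2) / 2, by nlinarith [mul_pos hA (pow_pos hs0 2)],
    by nlinarith [mul_pos hA (mul_pos (sub_pos.2 hs1) (by linarith : 0 < 1 + s))], ?_⟩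
  rw [← sub_neg, sub_g_param hA hs0.le]
  refine div_neg_of_neg_of_pos (mul_neg_of_pos_of_neg (by linarith) ?_) (by positivity)
  nlinarith [mul_pos (sub_pos.2 hcr) (by positivity : 0 < 1 + s ^ 2)]

lemma g_le {A a : ℝ} (hA : (1 + √2) / 2 ≤ A) (ha : A / 2 ≤ a) (haA : a ≤ A) :
    g A a ≤ A - 1 := by
  have hA0 : 0 < A := lt_of_lt_of_le (by positivity) hA
  have hnn : 0 ≤ 2 * a / A - 1 := by
    rw [sub_nonneg, le_div_iff₀ hA0]
    linarith
  obtain ⟨s, hs⟩ : ∃ s, s = √(2 * a / A - 1) := ⟨_, rfl⟩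
  have hs0 : 0 ≤ s := hs ▸ Real.sqrt_nonneg _
  have hs1 : s ≤ 1 := by
    rw [hs, Real.sqrt_le_one, sub_le_iff_le_add, div_le_iff₀ hA0]
    linarith
  have hsa : a = A * (1 + s ^ 2) / 2 := by
    rw [hs, Real.sq_sqrt hnn]
    field_simp
    ring
  rw [hsa, ← sub_nonneg, sub_g_param hA0 hs0]
  refine div_nonneg (mul_nonneg (by linarith) ?_) (by positivity)
  have hsq : 0 ≤ (1 + √2) / 2 * (s - (√2 - 1)) ^ 2 := by positivity
  rw [← critical_mul_sub] at hsq
  nlinarith [mul_nonneg (sub_nonneg.2 hA) (by positivity : 0 ≤ 1 + s ^ 2)]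

/-- First-order phase transition: there is a unique critical aspect ratio
`A_cr ∈ (1.207, 1.208)` such that for `1 < A < A_cr` the boundary excess
exceeds the regular-fold excess `A − 1` at some interior point, while for
`A > A_cr` it never does. -/
theorem phase_transition :
    ∃ Acr : ℝ, (1.207 < Acr ∧ Acr < 1.208) ∧
      (∀ A : ℝ, 1 < A → A < Acr →
        ∃ a : ℝ, A / 2 < a ∧ a < A ∧ A - 1 < g A a) ∧
      (∀ A : ℝ, Acr < A → ∀ a : ℝ, A / 2 ≤ a → a ≤ A → g A a ≤ A - 1) ∧
      (∀ Acr' : ℝ,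
        (∀ A : ℝ, 1 < A → A < Acr' →
          ∃ a : ℝ, A / 2 < a ∧ a < A ∧ A - 1 < g A a) →
        (∀ A : ℝ, Acr' < A → ∀ a : ℝ, A / 2 ≤ a → a ≤ A → g A a ≤ A - 1) →
        Acr' = Acr) := by
  have hlo : 1.414 < √2 := Real.lt_sqrt_of_sq_lt (by norm_num)
  have hhi : √2 < 1.416 := (Real.sqrt_lt' (by norm_num)).2 (by norm_num)
  refine ⟨(1 + √2) / 2, ⟨by linarith, by linarith⟩,
    fun A h1 hA => exists_lt_g (by linarith) hA,
    fun A hA a ha haA => g_le hA.le ha haA, fun Acr' hi hii => ?_⟩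
  rcases lt_trichotomy Acr' ((1 + √2) / 2) with h | h | h
  · obtain ⟨A, hA, hAcr⟩ := exists_between (max_lt h (by linarith : 1 < (1 + √2) / 2))
    obtain ⟨hA', hA1⟩ := max_lt_iff.1 hA
    obtain ⟨a, ha, haA, hg⟩ := exists_lt_g (by linarith) hAcr
    exact absurd (hii A hA' a ha.le haA.le) hg.not_ge
  · exact h
  · obtain ⟨A, hA, hAcr⟩ := exists_between h
    obtain ⟨a, ha, haA, hg⟩ := hi A (by linarith) hAcr
    exact absurd (g_le hA.le ha.le haA.le) hg.not_ge
end

section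
/- Let e(a,b) = 2b(a−b)/(1+(a−b)²) and let A ≥ 1. For every real b with 0 ≤ b ≤ A, one has 2b(A−b)/(1+(A−b)²) ≤ √(1+A²) − 1, with equality at b = (1 + A² − √(1+A²))/A. -/
/-- For an `A×1` rectangular page folded in case 2 with `a = A`, the excess
`2b(A−b)/(1+(A−b)²)` is at most `√(1+A²) − 1` on `[0,A]`, with equality at
`b = (1 + A² − √(1+A²))/A`. -/
theorem rect_excess_a_eq_A (A : ℝ) (hA : 1 ≤ A) :
    (∀ b : ℝ, 0 ≤ b → b ≤ A →
      2 * b * (A - b) / (1 + (A - b) ^ 2) ≤ Real.sqrt (1 + A ^ 2) - 1) ∧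
    2 * ((1 + A ^ 2 - Real.sqrt (1 + A ^ 2)) / A) *
        (A - (1 + A ^ 2 - Real.sqrt (1 + A ^ 2)) / A) /
        (1 + (A - (1 + A ^ 2 - Real.sqrt (1 + A ^ 2)) / A) ^ 2) =
      Real.sqrt (1 + A ^ 2) - 1 := by
  have hs : √(1 + A ^ 2) ^ 2 = 1 + A ^ 2 := Real.sq_sqrt (by positivity)
  have hs0 : 0 ≤ √(1 + A ^ 2) := Real.sqrt_nonneg _
  set s := √(1 + A ^ 2)
  have hA0 : A ≠ 0 := by positivity
  constructor
  · intro b _ _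
    rw [div_le_iff₀ (by positivity)]
    have hfactor : (s + 1) * ((s - 1) * (1 + (A - b) ^ 2) - 2 * b * (A - b)) =
        ((s + 1) * (A - b) - A) ^ 2 := by
      linear_combination hs
    have hnonneg : 0 ≤ (s - 1) * (1 + (A - b) ^ 2) - 2 * b * (A - b) := by
      refine nonneg_of_mul_nonneg_right ?_ (by positivity : 0 < s + 1)
      rw [hfactor]
      positivity
    linarith
  · have hcompl : A - (1 + A ^ 2 - s) / A = (s - 1) / A := by
      field_simp
      ring
    rw [hcompl, div_eq_iff (by positivity)]
    field_simp
    linear_combination (1 - s) * hs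
end
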